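/- arXiv:1312.5400 — 9 statements merged into one kernel-verified Lean document; each statement's English description precedes it below -/
import Mathlib

section
/- The cone identity (3.1) holds for all vectors of V̄ if and only if the three identities (3.2), (3.3) and (3.4) hold for all vectors of V. (Theorem 3.1: the curvature tensor of an almost contact metric manifold verifies the identities (3.2)–(3.4) if and only if the curvature tensor of the corresponding almost Hermitian cone verifies the almost Kähler curvature identity (3.1).) -/
open scoped RealInnerProductSpace

/-- The almost complex structure `J̄` of the algebraic cone `V × ℝ` over an almost
contact metric structure `(φ, ξ)`: `J̄(X, s) = (φX + sξ, −η(X))`. -/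
noncomputable def Jbar {V : Type*} [NormedAddCommGroup V] [InnerProductSpace ℝ V]
    (φ : V →ₗ[ℝ] V) (ξ : V) : V × ℝ → V × ℝ :=
  fun p => (φ p.1 + p.2 • ξ, -⟪ξ, p.1⟫)

/-- The curvature-like tensor `R̄` of the algebraic cone `V × ℝ`:
`R̄(X̄,Ȳ,Z̄,W̄) = R(X,Y,Z,W) − g(X,W)g(Y,Z) + g(Y,W)g(X,Z)`. -/
noncomputable def Rbar {V : Type*} [NormedAddCommGroup V] [InnerProductSpace ℝ V]
    (R : V →ₗ[ℝ] V →ₗ[ℝ] V →ₗ[ℝ] V →ₗ[ℝ] ℝ) :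
    V × ℝ → V × ℝ → V × ℝ → V × ℝ → ℝ :=
  fun X Y Z W =>
    R X.1 Y.1 Z.1 W.1 - ⟪X.1, W.1⟫ * ⟪Y.1, Z.1⟫ + ⟪Y.1, W.1⟫ * ⟪X.1, Z.1⟫

/-- The trilinear form `D̄` on the cone `V × ℝ` representing `∇̄J̄` at `t = 0`:
`D̄((A,r),(X,s),(Y,t)) = P(A,X,Y) − g(A,X)η(Y) + η(X)g(A,Y) + s·g(BA + φA, Y)
  − t·(Φ(A,X) + N(A,X))`. -/
noncomputable def Dbar {V : Type*} [NormedAddCommGroup V] [InnerProductSpace ℝ V]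
    (φ : V →ₗ[ℝ] V) (ξ : V) (P : V →ₗ[ℝ] V →ₗ[ℝ] V →ₗ[ℝ] ℝ) (B : V →ₗ[ℝ] V) :
    V × ℝ → V × ℝ → V × ℝ → ℝ :=
  fun A X Y =>
    P A.1 X.1 Y.1 - ⟪A.1, X.1⟫ * ⟪ξ, Y.1⟫ + ⟪ξ, X.1⟫ * ⟪A.1, Y.1⟫
      + X.2 * ⟪B A.1 + φ A.1, Y.1⟫ - Y.2 * (⟪φ A.1, X.1⟫ + ⟪B A.1, X.1⟫)

/-- Parseval's identity for sums of a linear functional and an inner product. -/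
lemma OrthonormalBasis.sum_add_inner_mul_add_inner
    {ι V : Type*} [Fintype ι] [NormedAddCommGroup V] [InnerProductSpace ℝ V]
    (e : OrthonormalBasis ι ℝ V) (f g : V →ₗ[ℝ] ℝ) (u v : V) :
    ∑ a, (f (e a) + ⟪e a, u⟫) * (g (e a) + ⟪e a, v⟫)
      = ∑ a, f (e a) * g (e a) + f v + g u + ⟪u, v⟫ := by
  have apply_eq_sum (h : V →ₗ[ℝ] ℝ) (w : V) : ∑ a, ⟪e a, w⟫ * h (e a) = h w := by
    conv_rhs => rw [← e.sum_repr' w]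
    simp
  have hf := apply_eq_sum f v
  have hg := apply_eq_sum g u
  have huv := e.sum_inner_mul_inner u v
  rw [← hf, ← hg, ← huv, ← Finset.sum_add_distrib, ← Finset.sum_add_distrib,
    ← Finset.sum_add_distrib]
  refine Finset.sum_congr rfl fun a _ => ?_
  rw [real_inner_comm (e a) u]
  ring

section Defects

variable {ι V : Type*} [Fintype ι] [NormedAddCommGroup V] [InnerProductSpace ℝ V]

/-- The difference of the two sides of the almost Kähler curvature identity on the cone. -/
noncomputable def coneDefect (φ : V →ₗ[ℝ] V) (ξ : V)
    (R : V →ₗ[ℝ] V →ₗ[ℝ] V →ₗ[ℝ] V →ₗ[ℝ] ℝ) (P : V →ₗ[ℝ] V →ₗ[ℝ] V →ₗ[ℝ] ℝ)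
    (B : V →ₗ[ℝ] V) (e : OrthonormalBasis ι ℝ V) (Xb Yb Zb Wb : V × ℝ) : ℝ :=
  Rbar R Xb Yb Zb Wb
    + Rbar R (Jbar φ ξ Xb) (Jbar φ ξ Yb) (Jbar φ ξ Zb) (Jbar φ ξ Wb)
    + Rbar R (Jbar φ ξ Xb) Yb (Jbar φ ξ Zb) Wb
    + Rbar R Xb (Jbar φ ξ Yb) Zb (Jbar φ ξ Wb)
    - Rbar R (Jbar φ ξ Xb) (Jbar φ ξ Yb) Zb Wb
    - Rbar R Xb Yb (Jbar φ ξ Zb) (Jbar φ ξ Wb)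
    + Rbar R (Jbar φ ξ Xb) Yb Zb (Jbar φ ξ Wb)
    + Rbar R Xb (Jbar φ ξ Yb) (Jbar φ ξ Zb) Wb
    - 2 * ((∑ a, Dbar φ ξ P B (e a, (0 : ℝ)) Xb Yb * Dbar φ ξ P B (e a, (0 : ℝ)) Zb Wb)
        + Dbar φ ξ P B ((0 : V), (1 : ℝ)) Xb Yb * Dbar φ ξ P B ((0 : V), (1 : ℝ)) Zb Wb)

/-- The part of the cone defect not involving the radial direction. -/
noncomputable def baseDefect (φ : V →ₗ[ℝ] V) (ξ : V)
    (R : V →ₗ[ℝ] V →ₗ[ℝ] V →ₗ[ℝ] V →ₗ[ℝ] ℝ) (P : V →ₗ[ℝ] V →ₗ[ℝ] V →ₗ[ℝ] ℝ)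
    (e : OrthonormalBasis ι ℝ V) (X Y Z W : V) : ℝ :=
  R X Y Z W + R (φ X) (φ Y) (φ Z) (φ W) + R (φ X) Y (φ Z) W + R X (φ Y) Z (φ W)
    - R (φ X) (φ Y) Z W - R X Y (φ Z) (φ W) + R (φ X) Y Z (φ W) + R X (φ Y) (φ Z) W
    + 4 * ⟪φ X, W⟫ * ⟪φ Y, Z⟫ - 4 * ⟪φ Y, W⟫ * ⟪φ X, Z⟫
    - 4 * ⟪X, W⟫ * ⟪Y, Z⟫ + 4 * ⟪Y, W⟫ * ⟪X, Z⟫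
    + 4 * ⟪X, W⟫ * ⟪ξ, Y⟫ * ⟪ξ, Z⟫ + 4 * ⟪Y, Z⟫ * ⟪ξ, X⟫ * ⟪ξ, W⟫
    - 4 * ⟪Y, W⟫ * ⟪ξ, X⟫ * ⟪ξ, Z⟫ - 4 * ⟪X, Z⟫ * ⟪ξ, Y⟫ * ⟪ξ, W⟫
    - (2 * (∑ a, P (e a) X Y * P (e a) Z W)
      + 2 * ⟪ξ, Z⟫ * P W X Y - 2 * ⟪ξ, W⟫ * P Z X Y
      + 2 * ⟪ξ, X⟫ * P Y Z W - 2 * ⟪ξ, Y⟫ * P X Z W)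

/-- The part of the cone defect with one argument in the radial direction. -/
noncomputable def radialDefect (φ : V →ₗ[ℝ] V) (ξ : V)
    (R : V →ₗ[ℝ] V →ₗ[ℝ] V →ₗ[ℝ] V →ₗ[ℝ] ℝ) (P : V →ₗ[ℝ] V →ₗ[ℝ] V →ₗ[ℝ] ℝ)
    (B : V →ₗ[ℝ] V) (e : OrthonormalBasis ι ℝ V) (Y Z W : V) : ℝ :=
  R ξ (φ Y) (φ Z) (φ W) + R ξ Y (φ Z) W - R ξ (φ Y) Z W + R ξ Y Z (φ W)
    - (2 * (∑ a, ⟪B (e a), Y⟫ * P (e a) Z W)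
      + 2 * ⟪ξ, Z⟫ * ⟪B W, Y⟫ - 2 * ⟪ξ, W⟫ * ⟪B Z, Y⟫
      + 2 * (∑ a, ⟪φ (e a), Y⟫ * P (e a) Z W))

/-- The part of the cone defect with two arguments in the radial direction. -/
noncomputable def biradialDefect (φ : V →ₗ[ℝ] V) (ξ : V)
    (R : V →ₗ[ℝ] V →ₗ[ℝ] V →ₗ[ℝ] V →ₗ[ℝ] ℝ)
    (B : V →ₗ[ℝ] V) (e : OrthonormalBasis ι ℝ V) (X Z : V) : ℝ :=
  R (φ X) ξ (φ Z) ξ + R X ξ Z ξ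
    - 2 * ∑ a, (⟪B (e a), X⟫ * ⟪B (e a), Z⟫ + ⟪φ (e a), Z⟫ * ⟪B (e a), X⟫
      + ⟪φ (e a), X⟫ * ⟪B (e a), Z⟫)

/-- An almost contact structure tensor compatible with the metric is skew-adjoint. -/
lemma inner_map_eq_neg_inner_map {φ : V →ₗ[ℝ] V} {ξ : V}
    (hφφ : ∀ X : V, φ (φ X) = -X + ⟪ξ, X⟫ • ξ) (hηφ : ∀ X : V, ⟪ξ, φ X⟫ = 0)
    (hg : ∀ X Y : V, ⟪φ X, φ Y⟫ = ⟪X, Y⟫ - ⟪ξ, X⟫ * ⟪ξ, Y⟫) (X Y : V) :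
    ⟪φ X, Y⟫ = -⟪X, φ Y⟫ := by
  have h := hg X (φ Y)
  rw [hφφ, hηφ, inner_add_right, inner_neg_right, inner_smul_right,
    real_inner_comm ξ (φ X), hηφ] at h
  linarith

/-- Contraction of `D̄` with itself over the base directions, with the metric part evaluated. -/
lemma sum_Dbar_mul_Dbar {φ : V →ₗ[ℝ] V} (hφ : ∀ X Y : V, ⟪φ X, Y⟫ = -⟪X, φ Y⟫) (ξ : V)
    (P : V →ₗ[ℝ] V →ₗ[ℝ] V →ₗ[ℝ] ℝ) (B : V →ₗ[ℝ] V) (e : OrthonormalBasis ι ℝ V)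
    (p q r w : V × ℝ) :
    ∑ a, Dbar φ ξ P B (e a, (0 : ℝ)) p q * Dbar φ ξ P B (e a, (0 : ℝ)) r w
      = ∑ a, (P (e a) p.1 q.1 + p.2 * ⟪B (e a), q.1⟫ - q.2 * ⟪B (e a), p.1⟫)
          * (P (e a) r.1 w.1 + r.2 * ⟪B (e a), w.1⟫ - w.2 * ⟪B (e a), r.1⟫)
        + Dbar φ ξ P B (-⟪ξ, w.1⟫ • r.1 + ⟪ξ, r.1⟫ • w.1 - r.2 • φ w.1 + w.2 • φ r.1, 0) p q
        + (P (-⟪ξ, q.1⟫ • p.1 + ⟪ξ, p.1⟫ • q.1 - p.2 • φ q.1 + q.2 • φ p.1) r.1 w.1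
          + r.2 * ⟪B (-⟪ξ, q.1⟫ • p.1 + ⟪ξ, p.1⟫ • q.1 - p.2 • φ q.1 + q.2 • φ p.1), w.1⟫
          - w.2 * ⟪B (-⟪ξ, q.1⟫ • p.1 + ⟪ξ, p.1⟫ • q.1 - p.2 • φ q.1 + q.2 • φ p.1), r.1⟫) := by
  let f (p q : V × ℝ) : V →ₗ[ℝ] ℝ :=
    (P.flip p.1).flip q.1 + p.2 • (innerₗ V q.1 ∘ₗ B) - q.2 • (innerₗ V p.1 ∘ₗ B)
  let u (p q : V × ℝ) : V := -⟪ξ, q.1⟫ • p.1 + ⟪ξ, p.1⟫ • q.1 - p.2 • φ q.1 + q.2 • φ p.1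
  have hf (p q : V × ℝ) (A : V) :
      f p q A = P A p.1 q.1 + p.2 * ⟪B A, q.1⟫ - q.2 * ⟪B A, p.1⟫ := by
    simp [f, LinearMap.flip_apply, real_inner_comm]
  have hD (p q : V × ℝ) (A : V) : Dbar φ ξ P B (A, 0) p q = f p q A + ⟪A, u p q⟫ := by
    simp only [Dbar, hf, u, inner_add_left, inner_add_right, inner_sub_right,
      real_inner_smul_right, hφ A]
    ring
  have h := e.sum_add_inner_mul_add_inner (f p q) (f r w) (u p q) (u r w)
  simp only [← hD] at h
  rw [h, ← hf r w,
    ← Finset.sum_congr rfl fun a _ => congrArg₂ (· * ·) (hf p q (e a)) (hf r w (e a))]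
  change _ = _ + Dbar φ ξ P B (u r w, 0) p q + f r w (u p q)
  rw [hD, real_inner_comm (u r w) (u p q)]
  ring

/-- Decomposition of the cone defect according to the radial components of the arguments. -/
lemma coneDefect_eq {φ : V →ₗ[ℝ] V} {ξ : V}
    (hφφ : ∀ X : V, φ (φ X) = -X + ⟪ξ, X⟫ • ξ)
    (hηφ : ∀ X : V, ⟪ξ, φ X⟫ = 0) (hηξ : ⟪ξ, ξ⟫ = (1 : ℝ))
    (hg : ∀ X Y : V, ⟪φ X, φ Y⟫ = ⟪X, Y⟫ - ⟪ξ, X⟫ * ⟪ξ, Y⟫)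
    {R : V →ₗ[ℝ] V →ₗ[ℝ] V →ₗ[ℝ] V →ₗ[ℝ] ℝ}
    (hskew₁ : ∀ X Y Z W : V, R X Y Z W = - R Y X Z W)
    (hskew₂ : ∀ X Y Z W : V, R X Y Z W = - R X Y W Z)
    (hsymm : ∀ X Y Z W : V, R X Y Z W = R Z W X Y)
    (P : V →ₗ[ℝ] V →ₗ[ℝ] V →ₗ[ℝ] ℝ) (B : V →ₗ[ℝ] V) (e : OrthonormalBasis ι ℝ V)
    (X Y Z W : V) (s t u v : ℝ) :
    coneDefect φ ξ R P B e (X, s) (Y, t) (Z, u) (W, v)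
      = baseDefect φ ξ R P e X Y Z W
        + s * radialDefect φ ξ R P B e Y Z W - t * radialDefect φ ξ R P B e X Z W
        + u * radialDefect φ ξ R P B e W X Y - v * radialDefect φ ξ R P B e Z X Y
        + s * u * biradialDefect φ ξ R B e Y W - s * v * biradialDefect φ ξ R B e Y Z
        - t * u * biradialDefect φ ξ R B e X W + t * v * biradialDefect φ ξ R B e X Z := by
  have hφ := inner_map_eq_neg_inner_map hφφ hηφ hg
  have hφ' (X Y : V) : ⟪X, φ Y⟫ = -⟪Y, φ X⟫ := by rw [← hφ, real_inner_comm]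
  have hφξ' (X : V) : ⟪φ X, ξ⟫ = 0 := by rw [real_inner_comm, hηφ]
  have apply_eq_sum (h : V →ₗ[ℝ] ℝ) (w : V) : ∑ a, ⟪e a, w⟫ * h (e a) = h w := by
    simpa using e.sum_add_inner_mul_add_inner 0 h w 0
  have sum_map_mul (h : V →ₗ[ℝ] ℝ) (w : V) : ∑ a, ⟪φ (e a), w⟫ * h (e a) = -h (φ w) := by
    simp only [hφ, neg_mul, Finset.sum_neg_distrib, apply_eq_sum]
  have sum_map_mul_P (w Z W : V) : ∑ a, ⟪φ (e a), w⟫ * P (e a) Z W = -P (φ w) Z W :=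
    sum_map_mul ((P.flip Z).flip W) w
  have sum_map_mul_B (w Z : V) : ∑ a, ⟪φ (e a), w⟫ * ⟪B (e a), Z⟫ = -⟪B (φ w), Z⟫ := by
    simpa [real_inner_comm] using sum_map_mul (innerₗ V Z ∘ₗ B) w
  have sum_eq : ∑ a, (P (e a) X Y + s * ⟪B (e a), Y⟫ - t * ⟪B (e a), X⟫)
        * (P (e a) Z W + u * ⟪B (e a), W⟫ - v * ⟪B (e a), Z⟫)
      = ∑ a, P (e a) X Y * P (e a) Z W
        + s * ∑ a, ⟪B (e a), Y⟫ * P (e a) Z W - t * ∑ a, ⟪B (e a), X⟫ * P (e a) Z W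
        + u * ∑ a, ⟪B (e a), W⟫ * P (e a) X Y - v * ∑ a, ⟪B (e a), Z⟫ * P (e a) X Y
        + s * u * ∑ a, ⟪B (e a), Y⟫ * ⟪B (e a), W⟫ - s * v * ∑ a, ⟪B (e a), Y⟫ * ⟪B (e a), Z⟫
        - t * u * ∑ a, ⟪B (e a), X⟫ * ⟪B (e a), W⟫
        + t * v * ∑ a, ⟪B (e a), X⟫ * ⟪B (e a), Z⟫ := by
    simp only [Finset.mul_sum, ← Finset.sum_add_distrib, ← Finset.sum_sub_distrib]
    exact Finset.sum_congr rfl fun a _ => by ring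
  have hR₁ (X Z W : V) : R X ξ Z W = -R ξ X Z W := hskew₁ ..
  have hR₂ (Z X Y : V) : R X Y Z ξ = -R X Y ξ Z := hskew₂ ..
  have hR₃ (X Y Z : V) : R X Y ξ Z = R ξ Z X Y := hsymm ..
  have hR₀ (Z W : V) : R ξ ξ Z W = 0 := by linarith [hskew₁ ξ ξ Z W]
  have hR₀' (X Y : V) : R X Y ξ ξ = 0 := by linarith [hskew₂ X Y ξ ξ]
  simp only [coneDefect, sum_Dbar_mul_Dbar hφ, sum_eq]
  simp only [baseDefect, radialDefect, biradialDefect, Finset.sum_add_distrib, sum_map_mul_P,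
    sum_map_mul_B]
  simp only [Rbar, Jbar, Dbar, map_add, map_sub, map_smul, map_zero, LinearMap.add_apply,
    LinearMap.sub_apply, LinearMap.smul_apply, LinearMap.zero_apply,
    smul_eq_mul, inner_add_left, inner_add_right, inner_sub_left, inner_neg_left,
    real_inner_smul_left, real_inner_smul_right, inner_zero_left,
    hφφ, hηφ, hηξ, hg, hφξ']
  simp only [hR₀, hR₀', hR₁ X, hR₁ Y, hR₁ (φ X), hR₁ (φ Y), hR₂ Z, hR₂ W, hR₂ (φ Z), hR₂ (φ W),
    hR₃ X, hR₃ (φ X), real_inner_comm ξ X, real_inner_comm ξ Y, hφ, hφ' Z, hφ' W]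
  rw [real_inner_comm X Z, real_inner_comm Y Z, real_inner_comm X W, real_inner_comm Y W]
  ring

end Defects

theorem curvature_identity_cone_iff
    {V : Type*} [NormedAddCommGroup V] [InnerProductSpace ℝ V] [FiniteDimensional ℝ V]
    (n : ℕ) (hn : 1 ≤ n) (hdim : Module.finrank ℝ V = 2 * n + 1)
    (φ : V →ₗ[ℝ] V) (ξ : V)
    (hφφ : ∀ X : V, φ (φ X) = -X + ⟪ξ, X⟫ • ξ)
    (hφξ : φ ξ = 0)
    (hηφ : ∀ X : V, ⟪ξ, φ X⟫ = 0)
    (hηξ : ⟪ξ, ξ⟫ = (1 : ℝ))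
    (hg : ∀ X Y : V, ⟪φ X, φ Y⟫ = ⟪X, Y⟫ - ⟪ξ, X⟫ * ⟪ξ, Y⟫)
    (R : V →ₗ[ℝ] V →ₗ[ℝ] V →ₗ[ℝ] V →ₗ[ℝ] ℝ)
    (hskew₁ : ∀ X Y Z W : V, R X Y Z W = - R Y X Z W)
    (hskew₂ : ∀ X Y Z W : V, R X Y Z W = - R X Y W Z)
    (hsymm : ∀ X Y Z W : V, R X Y Z W = R Z W X Y)
    (hbianchi : ∀ X Y Z W : V, R X Y Z W + R Y Z X W + R Z X Y W = 0)
    (P : V →ₗ[ℝ] V →ₗ[ℝ] V →ₗ[ℝ] ℝ)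
    (hPskew : ∀ A X Y : V, P A X Y = - P A Y X)
    (B : V →ₗ[ℝ] V)
    (hPξ : ∀ A Y : V, P A ξ Y = - ⟪φ (B A), Y⟫)
    (hBξ : ∀ A : V, ⟪B A, ξ⟫ = 0)
    (e : OrthonormalBasis (Fin (2 * n + 1)) ℝ V)
    :
    (∀ Xb Yb Zb Wb : V × ℝ,
      Rbar R Xb Yb Zb Wb
        + Rbar R (Jbar φ ξ Xb) (Jbar φ ξ Yb) (Jbar φ ξ Zb) (Jbar φ ξ Wb)
        + Rbar R (Jbar φ ξ Xb) Yb (Jbar φ ξ Zb) Wb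
        + Rbar R Xb (Jbar φ ξ Yb) Zb (Jbar φ ξ Wb)
        - Rbar R (Jbar φ ξ Xb) (Jbar φ ξ Yb) Zb Wb
        - Rbar R Xb Yb (Jbar φ ξ Zb) (Jbar φ ξ Wb)
        + Rbar R (Jbar φ ξ Xb) Yb Zb (Jbar φ ξ Wb)
        + Rbar R Xb (Jbar φ ξ Yb) (Jbar φ ξ Zb) Wb
      = 2 * ((∑ a, Dbar φ ξ P B (e a, (0 : ℝ)) Xb Yb * Dbar φ ξ P B (e a, (0 : ℝ)) Zb Wb)
          + Dbar φ ξ P B ((0 : V), (1 : ℝ)) Xb Yb * Dbar φ ξ P B ((0 : V), (1 : ℝ)) Zb Wb))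
    ↔
    ((∀ X Y Z W : V,
      R X Y Z W + R (φ X) (φ Y) (φ Z) (φ W) + R (φ X) Y (φ Z) W + R X (φ Y) Z (φ W)
        - R (φ X) (φ Y) Z W - R X Y (φ Z) (φ W) + R (φ X) Y Z (φ W) + R X (φ Y) (φ Z) W
        + 4 * ⟪φ X, W⟫ * ⟪φ Y, Z⟫ - 4 * ⟪φ Y, W⟫ * ⟪φ X, Z⟫
        - 4 * ⟪X, W⟫ * ⟪Y, Z⟫ + 4 * ⟪Y, W⟫ * ⟪X, Z⟫
        + 4 * ⟪X, W⟫ * ⟪ξ, Y⟫ * ⟪ξ, Z⟫ + 4 * ⟪Y, Z⟫ * ⟪ξ, X⟫ * ⟪ξ, W⟫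
        - 4 * ⟪Y, W⟫ * ⟪ξ, X⟫ * ⟪ξ, Z⟫ - 4 * ⟪X, Z⟫ * ⟪ξ, Y⟫ * ⟪ξ, W⟫
      = 2 * (∑ a, P (e a) X Y * P (e a) Z W)
          + 2 * ⟪ξ, Z⟫ * P W X Y - 2 * ⟪ξ, W⟫ * P Z X Y
          + 2 * ⟪ξ, X⟫ * P Y Z W - 2 * ⟪ξ, Y⟫ * P X Z W)
    ∧ (∀ Y Z W : V,
      R ξ (φ Y) (φ Z) (φ W) + R ξ Y (φ Z) W - R ξ (φ Y) Z W + R ξ Y Z (φ W)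
      = 2 * (∑ a, ⟪B (e a), Y⟫ * P (e a) Z W)
          + 2 * ⟪ξ, Z⟫ * ⟪B W, Y⟫ - 2 * ⟪ξ, W⟫ * ⟪B Z, Y⟫
          + 2 * (∑ a, ⟪φ (e a), Y⟫ * P (e a) Z W))
    ∧ (∀ X Z : V,
      R (φ X) ξ (φ Z) ξ + R X ξ Z ξ
      = 2 * ∑ a, (⟪B (e a), X⟫ * ⟪B (e a), Z⟫ + ⟪φ (e a), Z⟫ * ⟪B (e a), X⟫
          + ⟪φ (e a), X⟫ * ⟪B (e a), Z⟫))) := by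
  have key (X Y Z W : V) (s t u v : ℝ) :=
    coneDefect_eq hφφ hηφ hηξ hg hskew₁ hskew₂ hsymm P B e X Y Z W s t u v
  constructor
  · intro h
    have hcone (p q r w : V × ℝ) : coneDefect φ ξ R P B e p q r w = 0 := sub_eq_zero.2 (h p q r w)
    have hbase (X Y Z W : V) : baseDefect φ ξ R P e X Y Z W = 0 := by
      simpa [hcone] using (key X Y Z W 0 0 0 0).symm
    have hradial (Y Z W : V) : radialDefect φ ξ R P B e Y Z W = 0 := by
      simpa [hcone, hbase] using (key 0 Y Z W 1 0 0 0).symm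
    have hbiradial (X Z : V) : biradialDefect φ ξ R B e X Z = 0 := by
      simpa [hcone, hbase, hradial] using (key 0 X 0 Z 1 0 1 0).symm
    exact ⟨fun X Y Z W => sub_eq_zero.1 (hbase X Y Z W),
      fun Y Z W => sub_eq_zero.1 (hradial Y Z W), fun X Z => sub_eq_zero.1 (hbiradial X Z)⟩
  · rintro ⟨h₂, h₃, h₄⟩ ⟨X, s⟩ ⟨Y, t⟩ ⟨Z, u⟩ ⟨W, v⟩
    have hbase (X Y Z W : V) : baseDefect φ ξ R P e X Y Z W = 0 := sub_eq_zero.2 (h₂ X Y Z W)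
    have hradial (Y Z W : V) : radialDefect φ ξ R P B e Y Z W = 0 := sub_eq_zero.2 (h₃ Y Z W)
    have hbiradial (X Z : V) : biradialDefect φ ξ R B e X Z = 0 := sub_eq_zero.2 (h₄ X Z)
    refine sub_eq_zero.1 ((key X Y Z W s t u v).trans ?_)
    simp [hbase, hradial, hbiradial]
end

section
/- If the cone identity (3.1) holds for all vectors of V̄, then identity (3.2) holds for all X,Y,Z,W ∈ V (this is the component of (3.1) obtained by taking all four arguments in V). -/
open scoped RealInnerProductSpace

/-- Contracting a linear functional with a vector along an orthonormal basis evaluates it. -/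
theorem OrthonormalBasis.sum_apply_mul_inner {ι V : Type*} [Fintype ι] [NormedAddCommGroup V]
    [InnerProductSpace ℝ V] (e : OrthonormalBasis ι ℝ V) (f : V →ₗ[ℝ] ℝ) (T : V) :
    ∑ a, f (e a) * ⟪e a, T⟫ = f T := by
  conv_rhs => rw [← e.sum_repr' T]
  simp [map_sum, mul_comm]

/-- The structure endomorphism of an almost contact metric structure is skew-adjoint. -/
theorem inner_map_right_eq_neg_of_almostContact {V : Type*} [NormedAddCommGroup V]
    [InnerProductSpace ℝ V] {φ : V →ₗ[ℝ] V} {ξ : V}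
    (hφφ : ∀ X : V, φ (φ X) = -X + ⟪ξ, X⟫ • ξ) (hηφ : ∀ X : V, ⟪ξ, φ X⟫ = 0)
    (hg : ∀ X Y : V, ⟪φ X, φ Y⟫ = ⟪X, Y⟫ - ⟪ξ, X⟫ * ⟪ξ, Y⟫) (X Y : V) :
    ⟪X, φ Y⟫ = -⟪φ X, Y⟫ := by
  have h := hg X (φ Y)
  rw [hφφ, hηφ, inner_add_right, inner_neg_right, inner_smul_right,
    real_inner_comm ξ (φ X), hηφ] at h
  linarith

theorem cone_identity_implies_identity_32
    {V : Type*} [NormedAddCommGroup V] [InnerProductSpace ℝ V] [FiniteDimensional ℝ V]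
    (n : ℕ) (hn : 1 ≤ n) (hdim : Module.finrank ℝ V = 2 * n + 1)
    (φ : V →ₗ[ℝ] V) (ξ : V)
    (hφφ : ∀ X : V, φ (φ X) = -X + ⟪ξ, X⟫ • ξ)
    (hφξ : φ ξ = 0)
    (hηφ : ∀ X : V, ⟪ξ, φ X⟫ = 0)
    (hηξ : ⟪ξ, ξ⟫ = (1 : ℝ))
    (hg : ∀ X Y : V, ⟪φ X, φ Y⟫ = ⟪X, Y⟫ - ⟪ξ, X⟫ * ⟪ξ, Y⟫)
    (R : V →ₗ[ℝ] V →ₗ[ℝ] V →ₗ[ℝ] V →ₗ[ℝ] ℝ)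
    (hskew₁ : ∀ X Y Z W : V, R X Y Z W = - R Y X Z W)
    (hskew₂ : ∀ X Y Z W : V, R X Y Z W = - R X Y W Z)
    (hsymm : ∀ X Y Z W : V, R X Y Z W = R Z W X Y)
    (hbianchi : ∀ X Y Z W : V, R X Y Z W + R Y Z X W + R Z X Y W = 0)
    (P : V →ₗ[ℝ] V →ₗ[ℝ] V →ₗ[ℝ] ℝ)
    (hPskew : ∀ A X Y : V, P A X Y = - P A Y X)
    (B : V →ₗ[ℝ] V)
    (hPξ : ∀ A Y : V, P A ξ Y = - ⟪φ (B A), Y⟫)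
    (hBξ : ∀ A : V, ⟪B A, ξ⟫ = 0)
    (e : OrthonormalBasis (Fin (2 * n + 1)) ℝ V)
    (h31 :
      (∀ Xb Yb Zb Wb : V × ℝ,
      Rbar R Xb Yb Zb Wb
        + Rbar R (Jbar φ ξ Xb) (Jbar φ ξ Yb) (Jbar φ ξ Zb) (Jbar φ ξ Wb)
        + Rbar R (Jbar φ ξ Xb) Yb (Jbar φ ξ Zb) Wb
        + Rbar R Xb (Jbar φ ξ Yb) Zb (Jbar φ ξ Wb)
        - Rbar R (Jbar φ ξ Xb) (Jbar φ ξ Yb) Zb Wb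
        - Rbar R Xb Yb (Jbar φ ξ Zb) (Jbar φ ξ Wb)
        + Rbar R (Jbar φ ξ Xb) Yb Zb (Jbar φ ξ Wb)
        + Rbar R Xb (Jbar φ ξ Yb) (Jbar φ ξ Zb) Wb
      = 2 * ((∑ a, Dbar φ ξ P B (e a, (0 : ℝ)) Xb Yb * Dbar φ ξ P B (e a, (0 : ℝ)) Zb Wb)
          + Dbar φ ξ P B ((0 : V), (1 : ℝ)) Xb Yb * Dbar φ ξ P B ((0 : V), (1 : ℝ)) Zb Wb)))
    :
    (∀ X Y Z W : V,
      R X Y Z W + R (φ X) (φ Y) (φ Z) (φ W) + R (φ X) Y (φ Z) W + R X (φ Y) Z (φ W)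
        - R (φ X) (φ Y) Z W - R X Y (φ Z) (φ W) + R (φ X) Y Z (φ W) + R X (φ Y) (φ Z) W
        + 4 * ⟪φ X, W⟫ * ⟪φ Y, Z⟫ - 4 * ⟪φ Y, W⟫ * ⟪φ X, Z⟫
        - 4 * ⟪X, W⟫ * ⟪Y, Z⟫ + 4 * ⟪Y, W⟫ * ⟪X, Z⟫
        + 4 * ⟪X, W⟫ * ⟪ξ, Y⟫ * ⟪ξ, Z⟫ + 4 * ⟪Y, Z⟫ * ⟪ξ, X⟫ * ⟪ξ, W⟫
        - 4 * ⟪Y, W⟫ * ⟪ξ, X⟫ * ⟪ξ, Z⟫ - 4 * ⟪X, Z⟫ * ⟪ξ, Y⟫ * ⟪ξ, W⟫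
      = 2 * (∑ a, P (e a) X Y * P (e a) Z W)
          + 2 * ⟪ξ, Z⟫ * P W X Y - 2 * ⟪ξ, W⟫ * P Z X Y
          + 2 * ⟪ξ, X⟫ * P Y Z W - 2 * ⟪ξ, Y⟫ * P X Z W) := by
  intro X Y Z W
  have hskewφ := inner_map_right_eq_neg_of_almostContact hφφ hηφ hg
  have hD : ∀ A U T : V, Dbar φ ξ P B (A, 0) (U, 0) (T, 0)
      = P A U T + ⟪A, ⟪ξ, U⟫ • T - ⟪ξ, T⟫ • U⟫ := fun A U T => by
    simp only [Dbar, inner_sub_right, inner_smul_right]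
    ring
  have hcontr : ∀ U S T : V, P T U S = ∑ a, P (e a) U S * ⟪e a, T⟫ := fun U S T =>
    (e.sum_apply_mul_inner ((P.flip U).flip S) T).symm
  have hsum : ∑ a, Dbar φ ξ P B (e a, 0) (X, 0) (Y, 0) * Dbar φ ξ P B (e a, 0) (Z, 0) (W, 0)
      = (∑ a, P (e a) X Y * P (e a) Z W) + P (⟪ξ, Z⟫ • W - ⟪ξ, W⟫ • Z) X Y
        + P (⟪ξ, X⟫ • Y - ⟪ξ, Y⟫ • X) Z W
        + ⟪⟪ξ, X⟫ • Y - ⟪ξ, Y⟫ • X, ⟪ξ, Z⟫ • W - ⟪ξ, W⟫ • Z⟫ := by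
    rw [hcontr X Y, hcontr Z W, ← e.sum_inner_mul_inner (⟪ξ, X⟫ • Y - ⟪ξ, Y⟫ • X),
      ← Finset.sum_add_distrib, ← Finset.sum_add_distrib, ← Finset.sum_add_distrib]
    refine Finset.sum_congr rfl fun a _ => ?_
    rw [hD, hD, real_inner_comm (e a) (⟪ξ, X⟫ • Y - ⟪ξ, Y⟫ • X)]
    ring
  have hrad : Dbar φ ξ P B (0, 1) (X, 0) (Y, 0) = 0 := by simp [Dbar]
  have h := h31 (X, 0) (Y, 0) (Z, 0) (W, 0)
  rw [hsum, hrad] at h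
  simp only [Rbar, Jbar, zero_smul, add_zero, hg, hskewφ, inner_sub_left, inner_sub_right,
    real_inner_smul_left, real_inner_smul_right, map_sub, map_smul, LinearMap.sub_apply,
    LinearMap.smul_apply, smul_eq_mul] at h
  linear_combination h
end

section
/- (Lemma 4.3) The cone curvature tensor R̄ satisfies the identity (Ḡ3) if and only if R satisfies all of the identities (G3), (G3-1) and (G3-2). -/
open scoped RealInnerProductSpace

theorem gray3_cone_iff
    {V : Type*} [NormedAddCommGroup V] [InnerProductSpace ℝ V] [FiniteDimensional ℝ V]
    (n : ℕ) (hn : 1 ≤ n) (hdim : Module.finrank ℝ V = 2 * n + 1)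
    (φ : V →ₗ[ℝ] V) (ξ : V)
    (hφφ : ∀ X : V, φ (φ X) = -X + ⟪ξ, X⟫ • ξ)
    (hφξ : φ ξ = 0)
    (hηφ : ∀ X : V, ⟪ξ, φ X⟫ = 0)
    (hηξ : ⟪ξ, ξ⟫ = (1 : ℝ))
    (hg : ∀ X Y : V, ⟪φ X, φ Y⟫ = ⟪X, Y⟫ - ⟪ξ, X⟫ * ⟪ξ, Y⟫)
    (R : V →ₗ[ℝ] V →ₗ[ℝ] V →ₗ[ℝ] V →ₗ[ℝ] ℝ)
    (hskew₁ : ∀ X Y Z W : V, R X Y Z W = - R Y X Z W)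
    (hskew₂ : ∀ X Y Z W : V, R X Y Z W = - R X Y W Z)
    (hsymm : ∀ X Y Z W : V, R X Y Z W = R Z W X Y)
    (hbianchi : ∀ X Y Z W : V, R X Y Z W + R Y Z X W + R Z X Y W = 0)
    :
    (∀ Xb Yb Zb Wb : V × ℝ,
      Rbar R Xb Yb Zb Wb
      = Rbar R (Jbar φ ξ Xb) (Jbar φ ξ Yb) (Jbar φ ξ Zb) (Jbar φ ξ Wb))
    ↔
    ((∀ X Y Z W : V,
      R X Y Z W - R (φ X) (φ Y) (φ Z) (φ W)
      = ⟪X, W⟫ * ⟪ξ, Y⟫ * ⟪ξ, Z⟫ + ⟪Y, Z⟫ * ⟪ξ, X⟫ * ⟪ξ, W⟫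
          - ⟪X, Z⟫ * ⟪ξ, Y⟫ * ⟪ξ, W⟫ - ⟪Y, W⟫ * ⟪ξ, X⟫ * ⟪ξ, Z⟫)
    ∧ (∀ Y Z W : V, R ξ (φ Y) (φ Z) (φ W) = 0)
    ∧ (∀ Y W : V, R ξ (φ Y) ξ (φ W) = - ⟪Y, W⟫ + ⟪ξ, Y⟫ * ⟪ξ, W⟫)) := by
  constructor
  · intro h
    refine ⟨fun X Y Z W => ?_, fun Y Z W => ?_, fun Y W => ?_⟩
    · have := h (X, 0) (Y, 0) (Z, 0) (W, 0)
      simp only [Rbar, Jbar, zero_smul, add_zero, hg] at this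
      linear_combination this
    · have := h (0, 1) (Y, 0) (Z, 0) (W, 0)
      simp only [Rbar, Jbar, zero_smul, one_smul, add_zero, zero_add, map_zero, hηφ,
        LinearMap.zero_apply, inner_zero_left] at this
      linear_combination -this
    · have := h (0, 1) (Y, 0) (0, 1) (W, 0)
      simp only [Rbar, Jbar, zero_smul, one_smul, add_zero, zero_add, map_zero, hηφ, hηξ, hg,
        LinearMap.zero_apply, inner_zero_left, inner_zero_right] at this
      linear_combination -this
  · rintro ⟨hG3, hG31, hG32⟩ ⟨X, s⟩ ⟨Y, t⟩ ⟨Z, u⟩ ⟨W, v⟩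
    have hφη : ∀ X : V, ⟪φ X, ξ⟫ = 0 := fun X => by rw [real_inner_comm, hηφ]
    have hR₁₂ : ∀ Z W : V, R ξ ξ Z W = 0 := fun Z W => by linarith [hskew₁ ξ ξ Z W]
    have hR₃₄ : ∀ X Y : V, R X Y ξ ξ = 0 := fun X Y => by linarith [hskew₂ X Y ξ ξ]
    have hR₂ : ∀ X Z W : V, R (φ X) ξ (φ Z) (φ W) = 0 := fun X Z W => by
      rw [hskew₁, hG31, neg_zero]
    have hR₃ : ∀ X Y W : V, R (φ X) (φ Y) ξ (φ W) = 0 := fun X Y W => by rw [hsymm, hG31]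
    have hR₄ : ∀ X Y Z : V, R (φ X) (φ Y) (φ Z) ξ = 0 := fun X Y Z => by rw [hsymm, hR₂]
    have hR₁₄ : ∀ Y Z : V, R ξ (φ Y) (φ Z) ξ = ⟪Y, Z⟫ - ⟪ξ, Y⟫ * ⟪ξ, Z⟫ := fun Y Z => by
      rw [hskew₂, hG32]; ring
    have hR₂₃ : ∀ X W : V, R (φ X) ξ ξ (φ W) = ⟪X, W⟫ - ⟪ξ, X⟫ * ⟪ξ, W⟫ := fun X W => by
      rw [hskew₁, hG32]; ring
    have hR₂₄ : ∀ X Z : V, R (φ X) ξ (φ Z) ξ = -⟪X, Z⟫ + ⟪ξ, X⟫ * ⟪ξ, Z⟫ := fun X Z => by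
      rw [hskew₁, hR₁₄]; ring
    simp only [Rbar, Jbar, map_add, map_smul, LinearMap.add_apply, LinearMap.smul_apply,
      smul_eq_mul, inner_add_left, inner_add_right, real_inner_smul_left, real_inner_smul_right,
      hg, hηφ, hφη, hηξ, hR₁₂, hR₃₄, hG31, hR₂, hR₃, hR₄, hG32, hR₁₄, hR₂₃, hR₂₄]
    linear_combination hG3 X Y Z W
end

section
/- If R satisfies the identity (G2), then R satisfies the identity (G2-1). -/
open scoped RealInnerProductSpace

theorem G2_implies_G2_1
    {V : Type*} [NormedAddCommGroup V] [InnerProductSpace ℝ V] [FiniteDimensional ℝ V]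
    (n : ℕ) (hn : 1 ≤ n) (hdim : Module.finrank ℝ V = 2 * n + 1)
    (φ : V →ₗ[ℝ] V) (ξ : V)
    (hφφ : ∀ X : V, φ (φ X) = -X + ⟪ξ, X⟫ • ξ)
    (hφξ : φ ξ = 0)
    (hηφ : ∀ X : V, ⟪ξ, φ X⟫ = 0)
    (hηξ : ⟪ξ, ξ⟫ = (1 : ℝ))
    (hg : ∀ X Y : V, ⟪φ X, φ Y⟫ = ⟪X, Y⟫ - ⟪ξ, X⟫ * ⟪ξ, Y⟫)
    (R : V →ₗ[ℝ] V →ₗ[ℝ] V →ₗ[ℝ] V →ₗ[ℝ] ℝ)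
    (hskew₁ : ∀ X Y Z W : V, R X Y Z W = - R Y X Z W)
    (hskew₂ : ∀ X Y Z W : V, R X Y Z W = - R X Y W Z)
    (hsymm : ∀ X Y Z W : V, R X Y Z W = R Z W X Y)
    (hbianchi : ∀ X Y Z W : V, R X Y Z W + R Y Z X W + R Z X Y W = 0)
    (hG2 :
      (∀ X Y Z W : V,
      R X Y Z W - R (φ X) (φ Y) Z W - R (φ X) Y (φ Z) W - R (φ X) Y Z (φ W)
      = ⟪Y, Z⟫ * ⟪ξ, X⟫ * ⟪ξ, W⟫ - ⟪Y, W⟫ * ⟪ξ, X⟫ * ⟪ξ, Z⟫))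
    :
    (∀ Y Z W : V, R ξ (φ Y) Z W + R ξ Y (φ Z) W + R ξ Y Z (φ W) = 0) := by
  have hskew : ∀ X Y : V, ⟪φ X, Y⟫ = -⟪X, φ Y⟫ := by
    intro X Y
    have h := hg X (φ Y)
    rw [hφφ, hηφ, inner_add_right, inner_neg_right, inner_smul_right,
      real_inner_comm ξ (φ X), hηφ] at h
    linarith
  have hξ : ∀ Y Z W : V, R ξ Y Z W = ⟪Y, Z⟫ * ⟪ξ, W⟫ - ⟪Y, W⟫ * ⟪ξ, Z⟫ := by
    intro Y Z W
    simpa only [hφξ, hηξ, map_zero, LinearMap.zero_apply, sub_zero, mul_one] using hG2 ξ Y Z W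
  intro Y Z W
  rw [hξ, hξ, hξ, hηφ, hηφ, hskew, hskew]
  ring
end

section
/- If R satisfies the identity (G2), then R satisfies the identity (G2-2). -/
open scoped RealInnerProductSpace

theorem G2_implies_G2_2
    {V : Type*} [NormedAddCommGroup V] [InnerProductSpace ℝ V] [FiniteDimensional ℝ V]
    (n : ℕ) (hn : 1 ≤ n) (hdim : Module.finrank ℝ V = 2 * n + 1)
    (φ : V →ₗ[ℝ] V) (ξ : V)
    (hφφ : ∀ X : V, φ (φ X) = -X + ⟪ξ, X⟫ • ξ)
    (hφξ : φ ξ = 0)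
    (hηφ : ∀ X : V, ⟪ξ, φ X⟫ = 0)
    (hηξ : ⟪ξ, ξ⟫ = (1 : ℝ))
    (hg : ∀ X Y : V, ⟪φ X, φ Y⟫ = ⟪X, Y⟫ - ⟪ξ, X⟫ * ⟪ξ, Y⟫)
    (R : V →ₗ[ℝ] V →ₗ[ℝ] V →ₗ[ℝ] V →ₗ[ℝ] ℝ)
    (hskew₁ : ∀ X Y Z W : V, R X Y Z W = - R Y X Z W)
    (hskew₂ : ∀ X Y Z W : V, R X Y Z W = - R X Y W Z)
    (hsymm : ∀ X Y Z W : V, R X Y Z W = R Z W X Y)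
    (hbianchi : ∀ X Y Z W : V, R X Y Z W + R Y Z X W + R Z X Y W = 0)
    (hG2 :
      (∀ X Y Z W : V,
      R X Y Z W - R (φ X) (φ Y) Z W - R (φ X) Y (φ Z) W - R (φ X) Y Z (φ W)
      = ⟪Y, Z⟫ * ⟪ξ, X⟫ * ⟪ξ, W⟫ - ⟪Y, W⟫ * ⟪ξ, X⟫ * ⟪ξ, Z⟫))
    :
    (∀ X Z W : V, R (φ X) ξ Z W = ⟪ξ, Z⟫ * ⟪φ X, W⟫ - ⟪ξ, W⟫ * ⟪φ X, Z⟫) := by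
  intro X Z W
  have h := hG2 ξ (φ X) Z W
  simp only [hφξ, map_zero, LinearMap.zero_apply, sub_zero, hηξ, mul_one] at h
  rw [hskew₁, h]
  ring
end

section
/- If R satisfies the identity (G2), then R satisfies the identity (G2-3). -/
open scoped RealInnerProductSpace

theorem G2_implies_G2_3
    {V : Type*} [NormedAddCommGroup V] [InnerProductSpace ℝ V] [FiniteDimensional ℝ V]
    (n : ℕ) (hn : 1 ≤ n) (hdim : Module.finrank ℝ V = 2 * n + 1)
    (φ : V →ₗ[ℝ] V) (ξ : V)
    (hφφ : ∀ X : V, φ (φ X) = -X + ⟪ξ, X⟫ • ξ)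
    (hφξ : φ ξ = 0)
    (hηφ : ∀ X : V, ⟪ξ, φ X⟫ = 0)
    (hηξ : ⟪ξ, ξ⟫ = (1 : ℝ))
    (hg : ∀ X Y : V, ⟪φ X, φ Y⟫ = ⟪X, Y⟫ - ⟪ξ, X⟫ * ⟪ξ, Y⟫)
    (R : V →ₗ[ℝ] V →ₗ[ℝ] V →ₗ[ℝ] V →ₗ[ℝ] ℝ)
    (hskew₁ : ∀ X Y Z W : V, R X Y Z W = - R Y X Z W)
    (hskew₂ : ∀ X Y Z W : V, R X Y Z W = - R X Y W Z)
    (hsymm : ∀ X Y Z W : V, R X Y Z W = R Z W X Y)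
    (hbianchi : ∀ X Y Z W : V, R X Y Z W + R Y Z X W + R Z X Y W = 0)
    (hG2 :
      (∀ X Y Z W : V,
      R X Y Z W - R (φ X) (φ Y) Z W - R (φ X) Y (φ Z) W - R (φ X) Y Z (φ W)
      = ⟪Y, Z⟫ * ⟪ξ, X⟫ * ⟪ξ, W⟫ - ⟪Y, W⟫ * ⟪ξ, X⟫ * ⟪ξ, Z⟫))
    :
    (∀ X Y W : V, R (φ X) Y ξ W = ⟪ξ, Y⟫ * ⟪φ X, W⟫) := by
  intro X Y W
  have h := hG2 ξ W (φ X) Y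
  simp only [hφξ, hηφ, hηξ, map_zero, LinearMap.zero_apply, sub_zero, mul_one, mul_zero] at h
  rw [hsymm, h, real_inner_comm, mul_comm]
end

section
/- (Proposition 4.4) For each i = 1, 2, 3, the cone curvature tensor R̄ satisfies the identity (Ḡi) if and only if R satisfies the identity (Gi). -/
open scoped RealInnerProductSpace

/-- If contracting `ξ` into the first slot of `R` agrees with constant curvature one, then `R̄` does
not see a multiple of `ξ` added to the `V`-component of any of its arguments. -/
theorem Rbar_add_smul {V : Type*} [NormedAddCommGroup V] [InnerProductSpace ℝ V]
    (R : V →ₗ[ℝ] V →ₗ[ℝ] V →ₗ[ℝ] V →ₗ[ℝ] ℝ)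
    (hskew : ∀ X Y Z W : V, R X Y Z W = - R Y X Z W)
    (hsymm : ∀ X Y Z W : V, R X Y Z W = R Z W X Y) (ξ : V)
    (hξ : ∀ Y Z W : V, R ξ Y Z W = ⟪ξ, W⟫ * ⟪Y, Z⟫ - ⟪Y, W⟫ * ⟪ξ, Z⟫) :
    (∀ (X : V) (a s : ℝ) (Y Z W : V × ℝ),
      Rbar R (X + a • ξ, s) Y Z W = Rbar R (X, s) Y Z W) ∧
    (∀ (Y : V) (a s : ℝ) (X Z W : V × ℝ),
      Rbar R X (Y + a • ξ, s) Z W = Rbar R X (Y, s) Z W) ∧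
    (∀ (Z : V) (a s : ℝ) (X Y W : V × ℝ),
      Rbar R X Y (Z + a • ξ, s) W = Rbar R X Y (Z, s) W) ∧
    (∀ (W : V) (a s : ℝ) (X Y Z : V × ℝ),
      Rbar R X Y Z (W + a • ξ, s) = Rbar R X Y Z (W, s)) := by
  have first : ∀ (X : V) (a s : ℝ) (Y Z W : V × ℝ),
      Rbar R (X + a • ξ, s) Y Z W = Rbar R (X, s) Y Z W := by
    intro X a s Y Z W
    simp only [Rbar, map_add, map_smul, LinearMap.add_apply, LinearMap.smul_apply, smul_eq_mul,
      inner_add_left, real_inner_smul_left, hξ]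
    ring
  have skew : ∀ X Y Z W : V × ℝ, Rbar R X Y Z W = -Rbar R Y X Z W := by
    intro X Y Z W
    simp only [Rbar]
    rw [hskew]
    ring
  have symm : ∀ X Y Z W : V × ℝ, Rbar R X Y Z W = Rbar R Z W X Y := by
    intro X Y Z W
    simp only [Rbar]
    rw [hsymm, real_inner_comm X.1 W.1, real_inner_comm Y.1 Z.1, real_inner_comm Y.1 W.1,
      real_inner_comm X.1 Z.1]
    ring
  have second : ∀ (Y : V) (a s : ℝ) (X Z W : V × ℝ),
      Rbar R X (Y + a • ξ, s) Z W = Rbar R X (Y, s) Z W := by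
    intro Y a s X Z W
    rw [skew, first, ← skew]
  refine ⟨first, second, fun Z a s X Y W => ?_, fun W a s X Y Z => ?_⟩
  · rw [symm, first, ← symm]
  · rw [symm, second, ← symm]

theorem gray_cone_correspondence
    {V : Type*} [NormedAddCommGroup V] [InnerProductSpace ℝ V] [FiniteDimensional ℝ V]
    (n : ℕ) (hn : 1 ≤ n) (hdim : Module.finrank ℝ V = 2 * n + 1)
    (φ : V →ₗ[ℝ] V) (ξ : V)
    (hφφ : ∀ X : V, φ (φ X) = -X + ⟪ξ, X⟫ • ξ)
    (hφξ : φ ξ = 0)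
    (hηφ : ∀ X : V, ⟪ξ, φ X⟫ = 0)
    (hηξ : ⟪ξ, ξ⟫ = (1 : ℝ))
    (hg : ∀ X Y : V, ⟪φ X, φ Y⟫ = ⟪X, Y⟫ - ⟪ξ, X⟫ * ⟪ξ, Y⟫)
    (R : V →ₗ[ℝ] V →ₗ[ℝ] V →ₗ[ℝ] V →ₗ[ℝ] ℝ)
    (hskew₁ : ∀ X Y Z W : V, R X Y Z W = - R Y X Z W)
    (hskew₂ : ∀ X Y Z W : V, R X Y Z W = - R X Y W Z)
    (hsymm : ∀ X Y Z W : V, R X Y Z W = R Z W X Y)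
    (hbianchi : ∀ X Y Z W : V, R X Y Z W + R Y Z X W + R Z X Y W = 0)
    :
    ((∀ Xb Yb Zb Wb : V × ℝ,
      Rbar R Xb Yb Zb Wb = Rbar R Xb Yb (Jbar φ ξ Zb) (Jbar φ ξ Wb))
    ↔ (∀ X Y Z W : V,
      R X Y Z W - R X Y (φ Z) (φ W)
      = ⟪X, W⟫ * ⟪Y, Z⟫ - ⟪Y, W⟫ * ⟪X, Z⟫
          - ⟪φ X, W⟫ * ⟪φ Y, Z⟫ + ⟪φ Y, W⟫ * ⟪φ X, Z⟫))
    ∧ ((∀ Xb Yb Zb Wb : V × ℝ,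
      Rbar R Xb Yb Zb Wb
      = Rbar R (Jbar φ ξ Xb) (Jbar φ ξ Yb) Zb Wb
          + Rbar R (Jbar φ ξ Xb) Yb (Jbar φ ξ Zb) Wb
          + Rbar R (Jbar φ ξ Xb) Yb Zb (Jbar φ ξ Wb))
    ↔ (∀ X Y Z W : V,
      R X Y Z W - R (φ X) (φ Y) Z W - R (φ X) Y (φ Z) W - R (φ X) Y Z (φ W)
      = ⟪Y, Z⟫ * ⟪ξ, X⟫ * ⟪ξ, W⟫ - ⟪Y, W⟫ * ⟪ξ, X⟫ * ⟪ξ, Z⟫))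
    ∧ ((∀ Xb Yb Zb Wb : V × ℝ,
      Rbar R Xb Yb Zb Wb
      = Rbar R (Jbar φ ξ Xb) (Jbar φ ξ Yb) (Jbar φ ξ Zb) (Jbar φ ξ Wb))
    ↔ (∀ X Y Z W : V,
      R X Y Z W - R (φ X) (φ Y) (φ Z) (φ W)
      = ⟪X, W⟫ * ⟪ξ, Y⟫ * ⟪ξ, Z⟫ + ⟪Y, Z⟫ * ⟪ξ, X⟫ * ⟪ξ, W⟫
          - ⟪X, Z⟫ * ⟪ξ, Y⟫ * ⟪ξ, W⟫ - ⟪Y, W⟫ * ⟪ξ, X⟫ * ⟪ξ, Z⟫)) := by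
  have hφ_skew : ∀ X Y : V, ⟪X, φ Y⟫ = -⟪φ X, Y⟫ := by
    intro X Y
    have h := hg X (φ Y)
    rw [hφφ, inner_add_right, inner_neg_right, real_inner_smul_right, hηφ,
      real_inner_comm ξ (φ X), hηφ] at h
    linarith
  have hcomm : ∀ X : V, ⟪X, ξ⟫ = ⟪ξ, X⟫ := fun X => real_inner_comm ξ X
  refine ⟨⟨fun h X Y Z W => ?_, fun h => ?_⟩, ⟨fun h X Y Z W => ?_, fun h => ?_⟩,
    ⟨fun h X Y Z W => ?_, fun h => ?_⟩⟩
  · have h₀ := h (X, 0) (Y, 0) (Z, 0) (W, 0)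
    simp only [Rbar, Jbar, zero_smul, add_zero, hφ_skew] at h₀
    linear_combination h₀
  · have hξ : ∀ Y Z W : V, R ξ Y Z W = ⟪ξ, W⟫ * ⟪Y, Z⟫ - ⟪Y, W⟫ * ⟪ξ, Z⟫ := by
      intro Y Z W
      have h₀ := h Z W ξ Y
      simp only [hφξ, map_zero, LinearMap.zero_apply, hcomm, hηφ] at h₀
      rw [hsymm, real_inner_comm Z Y, real_inner_comm W Y]
      linear_combination h₀
    have hvan := Rbar_add_smul R hskew₁ hsymm ξ hξ
    rintro ⟨X, a⟩ ⟨Y, b⟩ ⟨Z, c⟩ ⟨W, d⟩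
    simp only [Jbar, hvan.2.2.1, hvan.2.2.2]
    have h₀ := h X Y Z W
    simp only [Rbar, hφ_skew]
    linear_combination h₀
  · have h₀ := h (X, 0) (Y, 0) (Z, 0) (W, 0)
    simp only [Rbar, Jbar, zero_smul, add_zero, hg] at h₀
    simp only [hφ_skew] at h₀
    linear_combination h₀
  · have hξ : ∀ Y Z W : V, R ξ Y Z W = ⟪ξ, W⟫ * ⟪Y, Z⟫ - ⟪Y, W⟫ * ⟪ξ, Z⟫ := by
      intro Y Z W
      have h₀ := h ξ Y Z W
      simp only [hφξ, map_zero, LinearMap.zero_apply, hηξ] at h₀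
      linear_combination h₀
    have hvan := Rbar_add_smul R hskew₁ hsymm ξ hξ
    rintro ⟨X, a⟩ ⟨Y, b⟩ ⟨Z, c⟩ ⟨W, d⟩
    simp only [Jbar, hvan.1, hvan.2.1, hvan.2.2.1, hvan.2.2.2]
    have h₀ := h X Y Z W
    simp only [Rbar, hg]
    simp only [hφ_skew]
    linear_combination h₀
  · have h₀ := h (X, 0) (Y, 0) (Z, 0) (W, 0)
    simp only [Rbar, Jbar, zero_smul, add_zero, hg] at h₀
    linear_combination h₀
  · have hξ : ∀ Y Z W : V, R ξ Y Z W = ⟪ξ, W⟫ * ⟪Y, Z⟫ - ⟪Y, W⟫ * ⟪ξ, Z⟫ := by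
      intro Y Z W
      have h₀ := h ξ Y Z W
      simp only [hφξ, map_zero, LinearMap.zero_apply, hηξ] at h₀
      linear_combination h₀
    have hvan := Rbar_add_smul R hskew₁ hsymm ξ hξ
    rintro ⟨X, a⟩ ⟨Y, b⟩ ⟨Z, c⟩ ⟨W, d⟩
    simp only [Jbar, hvan.1, hvan.2.1, hvan.2.2.1, hvan.2.2.2]
    have h₀ := h X Y Z W
    simp only [Rbar, hg]
    linear_combination h₀
end

section
/- If R satisfies the identity (G1), then R satisfies the identity (G2). (This is the implication (G1) ⇒ (G2) of the paper's relation (4.2), obtained from Gray's inclusions via the cone correspondence.) -/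
open scoped RealInnerProductSpace

theorem G1_implies_G2
    {V : Type*} [NormedAddCommGroup V] [InnerProductSpace ℝ V] [FiniteDimensional ℝ V]
    (n : ℕ) (hn : 1 ≤ n) (hdim : Module.finrank ℝ V = 2 * n + 1)
    (φ : V →ₗ[ℝ] V) (ξ : V)
    (hφφ : ∀ X : V, φ (φ X) = -X + ⟪ξ, X⟫ • ξ)
    (hφξ : φ ξ = 0)
    (hηφ : ∀ X : V, ⟪ξ, φ X⟫ = 0)
    (hηξ : ⟪ξ, ξ⟫ = (1 : ℝ))
    (hg : ∀ X Y : V, ⟪φ X, φ Y⟫ = ⟪X, Y⟫ - ⟪ξ, X⟫ * ⟪ξ, Y⟫)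
    (R : V →ₗ[ℝ] V →ₗ[ℝ] V →ₗ[ℝ] V →ₗ[ℝ] ℝ)
    (hskew₁ : ∀ X Y Z W : V, R X Y Z W = - R Y X Z W)
    (hskew₂ : ∀ X Y Z W : V, R X Y Z W = - R X Y W Z)
    (hsymm : ∀ X Y Z W : V, R X Y Z W = R Z W X Y)
    (hbianchi : ∀ X Y Z W : V, R X Y Z W + R Y Z X W + R Z X Y W = 0)
    (hG1 :
      (∀ X Y Z W : V,
      R X Y Z W - R X Y (φ Z) (φ W)
      = ⟪X, W⟫ * ⟪Y, Z⟫ - ⟪Y, W⟫ * ⟪X, Z⟫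
          - ⟪φ X, W⟫ * ⟪φ Y, Z⟫ + ⟪φ Y, W⟫ * ⟪φ X, Z⟫))
    :
    (∀ X Y Z W : V,
      R X Y Z W - R (φ X) (φ Y) Z W - R (φ X) Y (φ Z) W - R (φ X) Y Z (φ W)
      = ⟪Y, Z⟫ * ⟪ξ, X⟫ * ⟪ξ, W⟫ - ⟪Y, W⟫ * ⟪ξ, X⟫ * ⟪ξ, Z⟫) := by
  have hφξ' : ∀ A : V, ⟪φ A, ξ⟫ = (0 : ℝ) := fun A => by
    rw [real_inner_comm]; exact hηφ A
  have hskewφ : ∀ A B : V, ⟪A, φ B⟫ = -⟪φ A, B⟫ := fun A B => by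
    have h := hg A (φ B)
    rw [hφφ, hηφ, inner_add_right, inner_neg_right, real_inner_smul_right, hφξ'] at h
    linarith
  have hΦ : ∀ A B : V, ⟪φ A, B⟫ = -⟪φ B, A⟫ := fun A B => by
    rw [← hskewφ, real_inner_comm]
  intro X Y Z W
  have h₁ := hG1 Z W X Y
  rw [hsymm Z W X Y, hsymm Z W (φ X) (φ Y)] at h₁
  have h₂ := hG1 (φ X) Y (φ Z) W
  have h₃ := hG1 (φ X) Y ξ (φ W)
  simp only [hφφ, hφξ, hφξ', hg, hskewφ, map_add, map_neg, map_smul, map_zero,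
    LinearMap.add_apply, LinearMap.neg_apply, LinearMap.smul_apply, LinearMap.zero_apply,
    smul_eq_mul, inner_add_left, inner_neg_left, real_inner_smul_left, inner_zero_left] at h₁ h₂ h₃
  rw [real_inner_comm Y Z, real_inner_comm Y W, real_inner_comm X Z, real_inner_comm X W,
    hΦ Z Y, hΦ W Y, hΦ Z X, hΦ W X] at h₁
  rw [hηξ, real_inner_comm ξ Y, real_inner_comm ξ X] at h₃
  linear_combination h₁ - h₂ - ⟪ξ, Z⟫ * h₃
end

section
/- If R satisfies the identity (G2), then R satisfies the identity (G3). (This is the implication (G2) ⇒ (G3) of the paper's relation (4.2), obtained from Gray's inclusions via the cone correspondence.) -/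
open scoped RealInnerProductSpace

theorem G2_implies_G3
    {V : Type*} [NormedAddCommGroup V] [InnerProductSpace ℝ V] [FiniteDimensional ℝ V]
    (n : ℕ) (hn : 1 ≤ n) (hdim : Module.finrank ℝ V = 2 * n + 1)
    (φ : V →ₗ[ℝ] V) (ξ : V)
    (hφφ : ∀ X : V, φ (φ X) = -X + ⟪ξ, X⟫ • ξ)
    (hφξ : φ ξ = 0)
    (hηφ : ∀ X : V, ⟪ξ, φ X⟫ = 0)
    (hηξ : ⟪ξ, ξ⟫ = (1 : ℝ))
    (hg : ∀ X Y : V, ⟪φ X, φ Y⟫ = ⟪X, Y⟫ - ⟪ξ, X⟫ * ⟪ξ, Y⟫)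
    (R : V →ₗ[ℝ] V →ₗ[ℝ] V →ₗ[ℝ] V →ₗ[ℝ] ℝ)
    (hskew₁ : ∀ X Y Z W : V, R X Y Z W = - R Y X Z W)
    (hskew₂ : ∀ X Y Z W : V, R X Y Z W = - R X Y W Z)
    (hsymm : ∀ X Y Z W : V, R X Y Z W = R Z W X Y)
    (hbianchi : ∀ X Y Z W : V, R X Y Z W + R Y Z X W + R Z X Y W = 0)
    (hG2 :
      (∀ X Y Z W : V,
      R X Y Z W - R (φ X) (φ Y) Z W - R (φ X) Y (φ Z) W - R (φ X) Y Z (φ W)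
      = ⟪Y, Z⟫ * ⟪ξ, X⟫ * ⟪ξ, W⟫ - ⟪Y, W⟫ * ⟪ξ, X⟫ * ⟪ξ, Z⟫))
    :
    (∀ X Y Z W : V,
      R X Y Z W - R (φ X) (φ Y) (φ Z) (φ W)
      = ⟪X, W⟫ * ⟪ξ, Y⟫ * ⟪ξ, Z⟫ + ⟪Y, Z⟫ * ⟪ξ, X⟫ * ⟪ξ, W⟫
          - ⟪X, Z⟫ * ⟪ξ, Y⟫ * ⟪ξ, W⟫ - ⟪Y, W⟫ * ⟪ξ, X⟫ * ⟪ξ, Z⟫) := by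
  have hξ₁ : ∀ Y Z W : V, R ξ Y Z W = ⟪Y, Z⟫ * ⟪ξ, W⟫ - ⟪Y, W⟫ * ⟪ξ, Z⟫ := by
    intro Y Z W
    simpa only [hφξ, map_zero, LinearMap.zero_apply, sub_zero, hηξ, mul_one] using hG2 ξ Y Z W
  have hξ₂ : ∀ X Z W : V, R X ξ Z W = -(⟪X, Z⟫ * ⟪ξ, W⟫ - ⟪X, W⟫ * ⟪ξ, Z⟫) := by
    intro X Z W
    rw [hskew₁, hξ₁]
  have hξ₃ : ∀ X Y W : V, R X Y ξ W = ⟪W, X⟫ * ⟪ξ, Y⟫ - ⟪W, Y⟫ * ⟪ξ, X⟫ := by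
    intro X Y W
    rw [hsymm, hξ₁]
  have hξ₄ : ∀ X Y Z : V, R X Y Z ξ = -(⟪Z, X⟫ * ⟪ξ, Y⟫ - ⟪Z, Y⟫ * ⟪ξ, X⟫) := by
    intro X Y Z
    rw [hskew₂, hξ₃]
  -- The same identity with each of the other slots in the distinguished role.
  have hG2₂ : ∀ X Y Z W : V,
      R X Y Z W - R (φ X) (φ Y) Z W - R X (φ Y) (φ Z) W - R X (φ Y) Z (φ W)
      = -(⟪X, Z⟫ * ⟪ξ, Y⟫ * ⟪ξ, W⟫ - ⟪X, W⟫ * ⟪ξ, Y⟫ * ⟪ξ, Z⟫) := by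
    intro X Y Z W
    linarith [hG2 Y X Z W, hskew₁ X Y Z W, hskew₁ (φ X) (φ Y) Z W,
      hskew₁ X (φ Y) (φ Z) W, hskew₁ X (φ Y) Z (φ W)]
  have hG2₃ : ∀ X Y Z W : V,
      R X Y Z W - R X Y (φ Z) (φ W) - R (φ X) Y (φ Z) W - R X (φ Y) (φ Z) W
      = ⟪W, X⟫ * ⟪ξ, Z⟫ * ⟪ξ, Y⟫ - ⟪W, Y⟫ * ⟪ξ, Z⟫ * ⟪ξ, X⟫ := by
    intro X Y Z W
    linarith [hG2 Z W X Y, hsymm X Y Z W, hsymm X Y (φ Z) (φ W),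
      hsymm (φ X) Y (φ Z) W, hsymm X (φ Y) (φ Z) W]
  have hG2₄ : ∀ X Y Z W : V,
      R X Y Z W - R X Y (φ Z) (φ W) - R (φ X) Y Z (φ W) - R X (φ Y) Z (φ W)
      = -(⟪Z, X⟫ * ⟪ξ, W⟫ * ⟪ξ, Y⟫ - ⟪Z, Y⟫ * ⟪ξ, W⟫ * ⟪ξ, X⟫) := by
    intro X Y Z W
    linarith [hG2₃ X Y W Z, hskew₂ X Y Z W, hskew₂ X Y (φ Z) (φ W),
      hskew₂ (φ X) Y Z (φ W), hskew₂ X (φ Y) Z (φ W)]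
  intro X Y Z W
  have h₁ := hG2 (φ X) (φ Y) (φ Z) (φ W)
  have h₂ := hG2₂ (φ X) (φ Y) (φ Z) (φ W)
  have h₃ := hG2₃ (φ X) (φ Y) (φ Z) (φ W)
  have h₄ := hG2₄ (φ X) (φ Y) (φ Z) (φ W)
  have hφη : ∀ X : V, ⟪φ X, ξ⟫ = 0 := fun X => by rw [real_inner_comm, hηφ]
  simp only [hφφ, map_add, map_neg, map_smul, LinearMap.add_apply, LinearMap.neg_apply,
    LinearMap.smul_apply, smul_eq_mul, hξ₁, hξ₂, hξ₃, hξ₄, hηφ, hφη, hηξ, hg]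
    at h₁ h₂ h₃ h₄
  have e₁ := hG2 X Y Z W
  have e₂ := hG2₂ X Y Z W
  have e₃ := hG2₃ X Y Z W
  have e₄ := hG2₄ X Y Z W
  simp only [real_inner_comm X ξ, real_inner_comm Y ξ, real_inner_comm Z ξ, real_inner_comm W ξ,
    real_inner_comm X Z, real_inner_comm X W, real_inner_comm Y Z, real_inner_comm Y W]
    at h₁ h₂ h₃ h₄ e₁ e₂ e₃ e₄ ⊢
  linarith
end
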